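/- Let G ∈ ℝ, V > 0, and g ∈ [-1,1]. Define Θ(G,V,g) = (√V/√(V+g²))·exp((G+g)²/(2V + 2g² + 2|G+g|) − G²/(2V + 2|G|)) − g·G·(|G| + 2V)/(2(|G| + V)²) − 1. Then Θ(G,V,g) ≤ 0. -/

import Mathlib

lemma log_ge_of_le_one {t : ℝ} (ht : 0 < t) (ht1 : t ≤ 1) : (t - t⁻¹) / 2 ≤ Real.log t := by
  have h := Real.sinh_le_self_iff.2 (Real.log_nonpos ht.le ht1)
  rwa [Real.sinh_log ht] at h

/-- Logarithmic form of the potential inequality when the sign of `G ≥ 0` is preserved. -/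
lemma potential_log_of_add_nonneg {G V g : ℝ} (hV : 0 < V) (hG : 0 ≤ G) (hg : -1 ≤ g)
    (hg1 : g ≤ 1) (hGg : 0 ≤ G + g) :
    (G + g) ^ 2 / (V + g ^ 2 + (G + g)) - G ^ 2 / (V + G) ≤
      2 * Real.log (1 + g * (G * (G + 2 * V) / (2 * (V + G) ^ 2))) +
        Real.log ((V + g ^ 2) / V) := by
  have hS : 0 < V + G := by positivity
  have hVg : 0 < V + g ^ 2 := by positivity
  have hD : 0 < V + g ^ 2 + (G + g) := by positivity
  have hlogV : g ^ 2 / (V + g ^ 2) ≤ Real.log ((V + g ^ 2) / V) := by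
    have h := Real.one_sub_inv_le_log_of_pos (div_pos hVg hV)
    convert h using 1
    field_simp
    ring
  have hrat : (G + g) ^ 2 / (V + g ^ 2 + (G + g)) - G ^ 2 / (V + G) ≤
      g * (G * (G + 2 * V)) / (V + G) ^ 2 - g ^ 2 * G ^ 2 / (V + G) ^ 2 +
        g ^ 2 / (V + g ^ 2) := by
    set q := (1 + g) * (G * (G + 2 * V) - g * G ^ 2) / (V + G) ^ 2 with hq
    have hq0 : 0 ≤ q := by
      have h1 : 0 ≤ 1 + g := by linarith
      have h2 : 0 ≤ G * (G + 2 * V) - g * G ^ 2 := by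
        nlinarith [mul_nonneg hG hV.le, mul_nonneg (sub_nonneg.2 hg1) (sq_nonneg G)]
      positivity
    have hid : (G + g) ^ 2 / (V + g ^ 2 + (G + g)) - G ^ 2 / (V + G) =
        g * (G * (G + 2 * V)) / (V + G) ^ 2 - g ^ 2 * G ^ 2 / (V + G) ^ 2 +
          g ^ 2 * (1 - q) / (V + g ^ 2 + (G + g)) := by
      rw [hq]
      field_simp
      ring
    have hle : g ^ 2 * (1 - q) / (V + g ^ 2 + (G + g)) ≤ g ^ 2 / (V + g ^ 2) := by
      apply div_le_div₀ (sq_nonneg g) _ hVg (by linarith)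
      nlinarith [mul_nonneg (sq_nonneg g) hq0]
    linarith
  have hlog : g * (G * (G + 2 * V)) / (V + G) ^ 2 - g ^ 2 * G ^ 2 / (V + G) ^ 2 ≤
      2 * Real.log (1 + g * (G * (G + 2 * V) / (2 * (V + G) ^ 2))) := by
    set u := G / (V + G) with hu
    have hu0 : 0 ≤ u := by positivity
    have hu1 : u ≤ 1 := by rw [hu, div_le_one hS]; linarith
    have hx : g * (G * (G + 2 * V) / (2 * (V + G) ^ 2)) = g * u * (1 - u / 2) := by
      rw [hu]; field_simp; ring
    have hl : g * (G * (G + 2 * V)) / (V + G) ^ 2 - g ^ 2 * G ^ 2 / (V + G) ^ 2 =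
        2 * (g * u * (1 - u / 2)) - (g * u) ^ 2 := by
      rw [hu]; field_simp; ring
    rw [hx, hl]
    rcases le_total 0 g with h0 | h0
    · set x := g * u * (1 - u / 2) with hxd
      have hx0 : 0 ≤ x := mul_nonneg (mul_nonneg h0 hu0) (by linarith)
      have hxle : x ≤ g * u := by
        rw [hxd]; exact mul_le_of_le_one_right (mul_nonneg h0 hu0) (by linarith)
      have h := Real.le_log_one_add_of_nonneg hx0
      have h2 : x - x ^ 2 / 2 ≤ 2 * x / (x + 2) := by
        rw [le_div_iff₀ (by linarith)]
        nlinarith [pow_nonneg hx0 3]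
      nlinarith [pow_le_pow_left₀ hx0 hxle 2]
    · obtain ⟨k, rfl⟩ : ∃ k, g = -k := ⟨-g, by ring⟩
      have hk0 : 0 ≤ k := by linarith
      have hk1 : k ≤ 1 := by linarith
      have hku : k * u ≤ u := mul_le_of_le_one_left hu0 hk1
      have hku0 : 0 ≤ k * u := mul_nonneg hk0 hu0
      have hpos : 0 < 1 + -k * u * (1 - u / 2) := by nlinarith
      have h := log_ge_of_le_one hpos (by nlinarith)
      refine le_trans ?_ (mul_le_mul_of_nonneg_left h zero_le_two)
      have ht : (1 - (1 + -k * u * (1 - u / 2))) ^ 2 ≤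
          (k * u) ^ 2 * (1 + -k * u * (1 - u / 2)) := by
        have : 0 ≤ (k * u) ^ 2 * ((1 + -k * u * (1 - u / 2)) - (1 - u / 2) ^ 2) :=
          mul_nonneg (sq_nonneg _) (by nlinarith)
        linarith
      rw [show 2 * (-k * u * (1 - u / 2)) = 2 * ((1 + -k * u * (1 - u / 2)) - 1) by ring]
      generalize 1 + -k * u * (1 - u / 2) = t at hpos ht ⊢
      have hinv : (1 - t) ^ 2 / t ≤ (k * u) ^ 2 := (div_le_iff₀ hpos).2 ht
      have : (1 - t) ^ 2 / t = t⁻¹ - 2 + t := by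
        field_simp
        ring
      linarith
  linarith

/-- Logarithmic form of the potential inequality when adding `g = -(G + k)` to `G ≥ 0`
changes the sign. -/
lemma potential_log_of_add_nonpos {G V k : ℝ} (hV : 0 < V) (hG : 0 ≤ G) (hk : 0 ≤ k)
    (hk1 : G + k ≤ 1) :
    k ^ 2 / (V + (G + k) ^ 2 + k) - G ^ 2 / (V + G) ≤
      2 * Real.log (1 + -(G + k) * (G * (G + 2 * V) / (2 * (V + G) ^ 2))) +
        Real.log ((V + (G + k) ^ 2) / V) := by
  have hS : 0 < V + G := by positivity
  have hD : 0 < V + (G + k) ^ 2 + k := by positivity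
  have hA : 0 < 2 * V + (G + k) ^ 2 := by positivity
  have hlogV : 2 * (G + k) ^ 2 / (2 * V + (G + k) ^ 2) ≤
      Real.log ((V + (G + k) ^ 2) / V) := by
    have h := Real.le_log_one_add_of_nonneg (x := (G + k) ^ 2 / V) (by positivity)
    convert h using 1
    · field_simp
      ring
    · congr 1
      field_simp
  set p := (G + k) * (G * (G + 2 * V)) with hp
  have hp0 : 0 ≤ p := by positivity
  have hF : 0 < 2 * (V + G) ^ 2 - p := by
    have : p ≤ G * (G + 2 * V) := mul_le_of_le_one_left (by positivity) hk1
    nlinarith [sq_nonneg G, mul_nonneg hG hV.le, pow_pos hV 2]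
  have ht : 1 + -(G + k) * (G * (G + 2 * V) / (2 * (V + G) ^ 2)) =
      (2 * (V + G) ^ 2 - p) / (2 * (V + G) ^ 2) := by
    rw [hp]; field_simp; ring
  have hlog := log_ge_of_le_one (t := (2 * (V + G) ^ 2 - p) / (2 * (V + G) ^ 2))
    (by positivity) (by rw [div_le_one (by positivity)]; linarith)
  rw [ht]
  have hN : 0 ≤ 2 * (G + k) ^ 2 * (V + (G + k) ^ 2 + k) * (2 * (V + G) ^ 2) *
        (2 * (V + G) ^ 2 - p) +
      2 * G ^ 2 * (V + G) * (2 * V + (G + k) ^ 2) * (V + (G + k) ^ 2 + k) *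
        (2 * (V + G) ^ 2 - p) -
      k ^ 2 * (2 * V + (G + k) ^ 2) * (2 * (V + G) ^ 2) * (2 * (V + G) ^ 2 - p) -
      p * (4 * (V + G) ^ 2 - p) * (2 * V + (G + k) ^ 2) * (V + (G + k) ^ 2 + k) := by
    have key : ∀ w e : ℝ, 0 ≤ e → w = G + k + e →
        0 ≤ 2 * (G + k) ^ 2 * (V * w + (G + k) ^ 2 + k * w) * (2 * w * (V + G) ^ 2) *
          (2 * w * (V + G) ^ 2 - p) +
        2 * G ^ 2 * (V + G) * (2 * V * w + (G + k) ^ 2) * (V * w + (G + k) ^ 2 + k * w) *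
          (2 * w * (V + G) ^ 2 - p) -
        k ^ 2 * (2 * V * w + (G + k) ^ 2) * (2 * w * (V + G) ^ 2) *
          (2 * w * (V + G) ^ 2 - p) -
        p * (4 * w * (V + G) ^ 2 - p) * (2 * V * w + (G + k) ^ 2) *
          (V * w + (G + k) ^ 2 + k * w) := by
      rintro w e he rfl
      rw [hp]
      ring_nf
      positivity
    simpa using key 1 (1 - (G + k)) (by linarith) (by ring)
  have hrat : 0 ≤ 2 * (G + k) ^ 2 / (2 * V + (G + k) ^ 2) + G ^ 2 / (V + G) -
      k ^ 2 / (V + (G + k) ^ 2 + k) +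
      2 * (((2 * (V + G) ^ 2 - p) / (2 * (V + G) ^ 2) -
        ((2 * (V + G) ^ 2 - p) / (2 * (V + G) ^ 2))⁻¹) / 2) := by
    clear_value p
    have h := div_nonneg hN (mul_pos (mul_pos hA hD) (mul_pos
      (show 0 < 2 * (V + G) ^ 2 by positivity) hF)).le
    refine h.trans_eq ?_
    field_simp
    ring
  linarith

lemma potential_le_of_nonneg {G V g : ℝ} (hV : 0 < V) (hG : 0 ≤ G) (hg : -1 ≤ g)
    (hg1 : g ≤ 1) :
    Real.sqrt V / Real.sqrt (V + g ^ 2) *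
        Real.exp ((G + g) ^ 2 / (2 * V + 2 * g ^ 2 + 2 * |G + g|)
          - G ^ 2 / (2 * V + 2 * |G|))
      - g * G * (|G| + 2 * V) / (2 * (|G| + V) ^ 2) - 1 ≤ 0 := by
  have hS : 0 < V + G := by positivity
  have hVg : 0 < V + g ^ 2 := by positivity
  have hlog : (G + g) ^ 2 / (V + g ^ 2 + |G + g|) - G ^ 2 / (V + G) ≤
      2 * Real.log (1 + g * (G * (G + 2 * V) / (2 * (V + G) ^ 2))) +
        Real.log ((V + g ^ 2) / V) := by
    rcases le_total 0 (G + g) with h | h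
    · rw [abs_of_nonneg h]
      exact potential_log_of_add_nonneg hV hG hg hg1 h
    · have h' := potential_log_of_add_nonpos (k := -(G + g)) hV hG (by linarith) (by linarith)
      rw [abs_of_nonpos h]
      rwa [show -(G + -(G + g)) = g by ring, neg_sq, show (G + -(G + g)) ^ 2 = g ^ 2 by ring] at h'
  have hpos : 0 < 1 + g * (G * (G + 2 * V) / (2 * (V + G) ^ 2)) := by
    have h0 : 0 ≤ G * (G + 2 * V) / (2 * (V + G) ^ 2) := by positivity
    have h1 : G * (G + 2 * V) / (2 * (V + G) ^ 2) < 1 := by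
      rw [div_lt_one (by positivity)]
      nlinarith [sq_nonneg G, mul_nonneg hG hV.le, pow_pos hV 2]
    nlinarith
  have hexp : (G + g) ^ 2 / (2 * V + 2 * g ^ 2 + 2 * |G + g|) - G ^ 2 / (2 * V + 2 * |G|) ≤
      Real.log (1 + g * (G * (G + 2 * V) / (2 * (V + G) ^ 2))) +
        Real.log (Real.sqrt (V + g ^ 2) / Real.sqrt V) := by
    have h1 : (G + g) ^ 2 / (2 * V + 2 * g ^ 2 + 2 * |G + g|) - G ^ 2 / (2 * V + 2 * |G|) =
        ((G + g) ^ 2 / (V + g ^ 2 + |G + g|) - G ^ 2 / (V + G)) / 2 := by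
      rw [abs_of_nonneg hG]
      field_simp
    rw [h1, ← Real.sqrt_div hVg.le, Real.log_sqrt (by positivity)]
    linarith
  have hle := Real.exp_le_exp.2 hexp
  rw [Real.exp_add, Real.exp_log hpos, Real.exp_log (by positivity)] at hle
  have hsV := Real.sqrt_pos.2 hV
  have hsVg := Real.sqrt_pos.2 hVg
  have h := mul_le_mul_of_nonneg_left hle (div_pos hsV hsVg).le
  have heq : Real.sqrt V / Real.sqrt (V + g ^ 2) *
      ((1 + g * (G * (G + 2 * V) / (2 * (V + G) ^ 2))) *
        (Real.sqrt (V + g ^ 2) / Real.sqrt V)) =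
      g * G * (|G| + 2 * V) / (2 * (|G| + V) ^ 2) + 1 := by
    rw [abs_of_nonneg hG, mul_left_comm, div_mul_div_cancel₀ hsVg.ne', div_self hsV.ne',
      add_comm G V]
    ring
  linarith

theorem stmt_2 (G V g : ℝ) (hV : 0 < V) (hg : g ∈ Set.Icc (-1 : ℝ) 1) :
    Real.sqrt V / Real.sqrt (V + g ^ 2) *
        Real.exp ((G + g) ^ 2 / (2 * V + 2 * g ^ 2 + 2 * |G + g|)
          - G ^ 2 / (2 * V + 2 * |G|))
      - g * G * (|G| + 2 * V) / (2 * (|G| + V) ^ 2) - 1 ≤ 0 := by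
  rcases le_total 0 G with hG | hG
  · exact potential_le_of_nonneg hV hG hg.1 hg.2
  · have h := potential_le_of_nonneg (G := -G) (g := -g) hV (by linarith)
      (by linarith [hg.2]) (by linarith [hg.1])
    rw [← neg_add, abs_neg, abs_neg] at h
    simpa only [neg_sq, neg_mul_neg] using h
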